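/- Let (𝒳, ⪯) be a finite poset whose order connects 𝒳, let f : 𝒳 → ℝ be strictly increasing, let P be a stochastic matrix on 𝒳, and let 𝔳 ≥ 0. If W(P(x,·), P(y,·)) ≤ 𝔳·ρ_f(x,y) holds for every edge {x,y} of the Hasse diagram, then W(P(x,·), P(y,·)) ≤ 𝔳·ρ_f(x,y) holds for all x, y ∈ 𝒳, where W is the Wasserstein distance with respect to ρ_f. -/

import Mathlib

/-- `ρ` is a metric on `X`. -/
def IsMetric {X : Type*} (ρ : X → X → ℝ) : Prop :=
  (∀ x y, ρ x y = 0 ↔ x = y) ∧ (∀ x y, ρ x y = ρ y x) ∧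
    (∀ x y, 0 ≤ ρ x y) ∧ ∀ x y z, ρ x z ≤ ρ x y + ρ y z

/-- `μ` is a probability vector on `X`. -/
def IsProbVec {X : Type*} [Fintype X] (μ : X → ℝ) : Prop :=
  (∀ x, 0 ≤ μ x) ∧ ∑ x, μ x = 1

/-- `π` is a coupling of `μ` and `ν`. -/
def IsCoupling {X : Type*} [Fintype X] (μ ν : X → ℝ) (π : X → X → ℝ) : Prop :=
  (∀ x y, 0 ≤ π x y) ∧ (∀ x, ∑ y, π x y = μ x) ∧ ∀ y, ∑ x, π x y = ν y

/-- The Wasserstein distance between `μ` and `ν` for the cost `ρ`: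
the infimum over couplings of the expected distance. -/
noncomputable def wass {X : Type*} [Fintype X] (ρ : X → X → ℝ) (μ ν : X → ℝ) : ℝ :=
  sInf {c : ℝ | ∃ π : X → X → ℝ, IsCoupling μ ν π ∧ c = ∑ x, ∑ y, π x y * ρ x y}

/-- Adjacency in the Hasse diagram of the poset `X`: `x ⋖ y` or `y ⋖ x`. -/
def HasseAdj {X : Type*} [PartialOrder X] (x y : X) : Prop := x ⋖ y ∨ y ⋖ x

/-- The path metric `ρ_f` induced by `f` on the Hasse diagram: the minimum over paths
`σ = (σ₀, …, σ_ℓ)` from `x` to `y` of `∑ᵢ |f(σᵢ) - f(σᵢ₋₁)|`. -/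
noncomputable def pathMetric {X : Type*} [PartialOrder X] (f : X → ℝ) (x y : X) : ℝ :=
  sInf {c : ℝ | ∃ σ : List X, List.Chain HasseAdj x σ ∧
    (x :: σ).getLast (List.cons_ne_nil x σ) = y ∧
    c = (((x :: σ).zip σ).map (fun p => |f p.2 - f p.1|)).sum}

open Matrix

/-- `P` is a stochastic matrix: nonnegative entries and rows summing to one. -/
def IsStochastic {X : Type*} [Fintype X] (P : Matrix X X ℝ) : Prop :=
  (∀ x y, 0 ≤ P x y) ∧ ∀ x, ∑ y, P x y = 1

/-- The partial order connects `X`. -/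
def Connects (X : Type*) [PartialOrder X] : Prop :=
  ∀ x y : X, Relation.ReflTransGen (fun a b : X => a ≤ b ∨ b ≤ a) x y

section Wasserstein

variable {X : Type*} [Fintype X] {ρ : X → X → ℝ} {μ ν κ : X → ℝ}

theorem wass_le_of_isCoupling (hρ : ∀ x y, 0 ≤ ρ x y) {π : X → X → ℝ} (hπ : IsCoupling μ ν π) :
    wass ρ μ ν ≤ ∑ x, ∑ y, π x y * ρ x y := by
  refine csInf_le ⟨0, ?_⟩ ⟨π, hπ, rfl⟩
  rintro _ ⟨π', hπ', rfl⟩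
  exact Finset.sum_nonneg fun x _ => Finset.sum_nonneg fun y _ => mul_nonneg (hπ'.1 x y) (hρ x y)

theorem isCoupling_mul (hμ : IsProbVec μ) (hν : IsProbVec ν) :
    IsCoupling μ ν fun x y => μ x * ν y :=
  ⟨fun x y => mul_nonneg (hμ.1 x) (hν.1 y), fun x => by rw [← Finset.mul_sum, hν.2, mul_one],
    fun y => by rw [← Finset.sum_mul, hμ.2, one_mul]⟩

theorem le_wass_of_forall_isCoupling (hμ : IsProbVec μ) (hν : IsProbVec ν) {a : ℝ}
    (h : ∀ π, IsCoupling μ ν π → a ≤ ∑ x, ∑ y, π x y * ρ x y) : a ≤ wass ρ μ ν := by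
  refine le_csInf ⟨_, _, isCoupling_mul hμ hν, rfl⟩ ?_
  rintro _ ⟨π, hπ, rfl⟩
  exact h π hπ

theorem wass_self_nonpos (hρ : ∀ x y, 0 ≤ ρ x y) (hρ_self : ∀ x, ρ x x = 0)
    (hμ : ∀ x, 0 ≤ μ x) : wass ρ μ μ ≤ 0 := by
  classical
  have hdiag : IsCoupling μ μ fun x y => if x = y then μ x else 0 :=
    ⟨fun x y => by
      dsimp only
      split_ifs
      exacts [hμ x, le_rfl], fun x => by simp, fun y => by simp⟩
  refine (wass_le_of_isCoupling hρ hdiag).trans_eq ?_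
  simp [ite_mul, hρ_self]

/-- Gluing of two couplings along their common marginal `ν`. -/
noncomputable def glue (ν : X → ℝ) (π₁ π₂ : X → X → ℝ) (x z : X) : ℝ :=
  ∑ y, π₁ x y * π₂ y z / ν y

namespace IsCoupling

variable {π₁ π₂ : X → X → ℝ}

theorem left_nonneg (h : IsCoupling μ ν π₁) (x : X) : 0 ≤ μ x := by
  rw [← h.2.1 x]
  exact Finset.sum_nonneg fun y _ => h.1 x y

theorem right_nonneg (h : IsCoupling μ ν π₁) (y : X) : 0 ≤ ν y := by
  rw [← h.2.2 y]
  exact Finset.sum_nonneg fun x _ => h.1 x y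

theorem sum_glue_right (h₁ : IsCoupling μ ν π₁) (h₂ : IsCoupling ν κ π₂) (x y : X) :
    ∑ z, π₁ x y * π₂ y z / ν y = π₁ x y := by
  rw [← Finset.sum_div, ← Finset.mul_sum, h₂.2.1]
  refine mul_div_cancel_of_imp fun hy => ?_
  have h := h₁.2.2 y
  rw [hy, Finset.sum_eq_zero_iff_of_nonneg fun x _ => h₁.1 x y] at h
  exact h x (Finset.mem_univ x)

theorem sum_glue_left (h₁ : IsCoupling μ ν π₁) (h₂ : IsCoupling ν κ π₂) (y z : X) :
    ∑ x, π₁ x y * π₂ y z / ν y = π₂ y z := by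
  rw [← Finset.sum_div, ← Finset.sum_mul, h₁.2.2]
  refine mul_div_cancel_left_of_imp fun hy => ?_
  have h := h₂.2.1 y
  rw [hy, Finset.sum_eq_zero_iff_of_nonneg fun z _ => h₂.1 y z] at h
  exact h z (Finset.mem_univ z)

theorem glue_term_nonneg (h₁ : IsCoupling μ ν π₁) (h₂ : IsCoupling ν κ π₂) (x y z : X) :
    0 ≤ π₁ x y * π₂ y z / ν y :=
  div_nonneg (mul_nonneg (h₁.1 x y) (h₂.1 y z)) (h₂.left_nonneg y)

theorem glue (h₁ : IsCoupling μ ν π₁) (h₂ : IsCoupling ν κ π₂) :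
    IsCoupling μ κ (glue ν π₁ π₂) := by
  refine ⟨fun x z => Finset.sum_nonneg fun y _ => h₁.glue_term_nonneg h₂ x y z,
    fun x => ?_, fun z => ?_⟩
  · simp only [_root_.glue]
    rw [Finset.sum_comm]
    simp only [h₁.sum_glue_right h₂, h₁.2.1]
  · simp only [_root_.glue]
    rw [Finset.sum_comm]
    simp only [h₁.sum_glue_left h₂, h₂.2.2]

theorem glue_cost_le (htri : ∀ x y z, ρ x z ≤ ρ x y + ρ y z)
    (h₁ : IsCoupling μ ν π₁) (h₂ : IsCoupling ν κ π₂) :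
    ∑ x, ∑ z, _root_.glue ν π₁ π₂ x z * ρ x z ≤
      ∑ x, ∑ y, π₁ x y * ρ x y + ∑ y, ∑ z, π₂ y z * ρ y z := by
  calc ∑ x, ∑ z, _root_.glue ν π₁ π₂ x z * ρ x z
      = ∑ x, ∑ z, ∑ y, π₁ x y * π₂ y z / ν y * ρ x z := by
        simp only [_root_.glue, Finset.sum_mul]
    _ ≤ ∑ x, ∑ z, ∑ y, π₁ x y * π₂ y z / ν y * (ρ x y + ρ y z) := by
        gcongr with x _ z _ y _
        · exact h₁.glue_term_nonneg h₂ x y z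
        · exact htri x y z
    _ = ∑ x, ∑ y, ∑ z, π₁ x y * π₂ y z / ν y * ρ x y +
          ∑ y, ∑ z, ∑ x, π₁ x y * π₂ y z / ν y * ρ y z := by
        simp only [mul_add, Finset.sum_add_distrib]
        congr 1
        · exact Finset.sum_congr rfl fun x _ => Finset.sum_comm
        · rw [Finset.sum_comm, Finset.sum_comm (s := Finset.univ (α := X)) (t := Finset.univ)
            (f := fun y z => ∑ x, π₁ x y * π₂ y z / ν y * ρ y z)]
          exact Finset.sum_congr rfl fun z _ => Finset.sum_comm
    _ = _ := by
        simp only [← Finset.sum_mul, h₁.sum_glue_right h₂, h₁.sum_glue_left h₂]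

end IsCoupling

theorem wass_triangle (hρ : ∀ x y, 0 ≤ ρ x y) (htri : ∀ x y z, ρ x z ≤ ρ x y + ρ y z)
    (hμ : IsProbVec μ) (hν : IsProbVec ν) (hκ : IsProbVec κ) :
    wass ρ μ κ ≤ wass ρ μ ν + wass ρ ν κ := by
  rw [← sub_le_iff_le_add]
  refine le_wass_of_forall_isCoupling hμ hν fun π₁ h₁ => ?_
  rw [sub_le_comm]
  refine le_wass_of_forall_isCoupling hν hκ fun π₂ h₂ => ?_
  rw [sub_le_iff_le_add']
  exact (wass_le_of_isCoupling hρ (h₁.glue h₂)).trans (h₁.glue_cost_le htri h₂)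

end Wasserstein

section PathMetric

variable {X : Type*} [PartialOrder X] {f : X → ℝ} {x y z : X} {a b : ℝ}

/-- `HassePath f x y c`: some path from `x` to `y` in the Hasse diagram has `f`-length `c`. -/
inductive HassePath (f : X → ℝ) : X → X → ℝ → Prop
  | refl (x : X) : HassePath f x x 0
  | head {x y z : X} {c : ℝ} : HasseAdj x y → HassePath f y z c →
      HassePath f x z (|f y - f x| + c)

namespace HassePath

theorem nonneg (h : HassePath f x y a) : 0 ≤ a := by
  induction h with
  | refl => exact le_rfl
  | head _ _ ih => positivity

theorem trans (h₁ : HassePath f x y a) (h₂ : HassePath f y z b) : HassePath f x z (a + b) := by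
  induction h₁ with
  | refl => rwa [zero_add]
  | head hadj _ ih =>
    rw [add_assoc]
    exact head hadj (ih h₂)

theorem exists_of_reflTransGen (h : Relation.ReflTransGen HasseAdj x y) :
    ∃ c, HassePath f x y c := by
  induction h using Relation.ReflTransGen.head_induction_on with
  | refl => exact ⟨0, refl y⟩
  | head hadj _ ih =>
    obtain ⟨c, hc⟩ := ih
    exact ⟨_, head hadj hc⟩

theorem iff_exists_isChain : HassePath f x y a ↔ ∃ σ : List X, List.IsChain HasseAdj (x :: σ) ∧
    (x :: σ).getLast (List.cons_ne_nil x σ) = y ∧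
    a = (((x :: σ).zip σ).map (fun p => |f p.2 - f p.1|)).sum := by
  constructor
  · intro h
    induction h with
    | refl x => exact ⟨[], .singleton x, rfl, by simp⟩
    | @head x y z c hadj _ ih =>
      obtain ⟨σ, hσ, hlast, rfl⟩ := ih
      exact ⟨y :: σ, List.IsChain.cons_cons hadj hσ, by simpa using hlast, by simp⟩
  · rintro ⟨σ, hσ, hlast, rfl⟩
    induction σ generalizing x with
    | nil =>
      obtain rfl : x = y := by simpa using hlast
      simpa using refl (f := f) x
    | cons w σ ih =>
      obtain ⟨hadj, hσ'⟩ := List.isChain_cons_cons.1 hσ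
      simpa using head hadj (ih hσ' (by simpa using hlast))

end HassePath

theorem pathMetric_eq_sInf (f : X → ℝ) (x y : X) :
    pathMetric f x y = sInf {c | HassePath f x y c} := by
  simp only [HassePath.iff_exists_isChain]
  rfl

theorem pathMetric_nonneg (f : X → ℝ) (x y : X) : 0 ≤ pathMetric f x y := by
  rw [pathMetric_eq_sInf]
  exact Real.sInf_nonneg fun _ h => h.nonneg

theorem HassePath.pathMetric_le (h : HassePath f x y a) : pathMetric f x y ≤ a := by
  rw [pathMetric_eq_sInf]
  exact csInf_le ⟨0, fun _ h => h.nonneg⟩ h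

theorem pathMetric_self (f : X → ℝ) (x : X) : pathMetric f x x = 0 :=
  (HassePath.refl x).pathMetric_le.antisymm (pathMetric_nonneg f x x)

theorem HasseAdj.pathMetric_le (h : HasseAdj x y) : pathMetric f x y ≤ |f y - f x| := by
  simpa using (HassePath.head (f := f) h (HassePath.refl y)).pathMetric_le

variable [Finite X]

theorem Connects.reflTransGen_hasseAdj (hconn : Connects X) (x y : X) :
    Relation.ReflTransGen HasseAdj x y := by
  classical
  have := Fintype.ofFinite X
  let _ : LocallyFiniteOrder X := Fintype.toLocallyFiniteOrder
  have hle : ∀ a b : X, a ≤ b → Relation.ReflTransGen HasseAdj a b := fun a b hab =>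
    Relation.ReflTransGen.mono (fun _ _ h => Or.inl h) _ _ (le_iff_reflTransGen_covBy.1 hab)
  induction hconn x y with
  | refl => exact .refl
  | tail _ h ih =>
    refine ih.trans (h.elim (hle _ _) fun h => ?_)
    have : Std.Symm (HasseAdj (X := X)) := ⟨fun _ _ h => Or.symm h⟩
    exact Std.Symm.symm _ _ (hle _ _ h)

theorem Connects.le_pathMetric (hconn : Connects X) (h : ∀ c, HassePath f x y c → a ≤ c) :
    a ≤ pathMetric f x y := by
  rw [pathMetric_eq_sInf]
  exact le_csInf (HassePath.exists_of_reflTransGen (hconn.reflTransGen_hasseAdj x y)) h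

theorem Connects.pathMetric_triangle (hconn : Connects X) (f : X → ℝ) (x y z : X) :
    pathMetric f x z ≤ pathMetric f x y + pathMetric f y z := by
  rw [← sub_le_iff_le_add]
  refine hconn.le_pathMetric fun c₁ h₁ => ?_
  rw [sub_le_comm]
  refine hconn.le_pathMetric fun c₂ h₂ => ?_
  rw [sub_le_iff_le_add']
  exact (h₁.trans h₂).pathMetric_le

end PathMetric

/-- **Extension from Hasse edges to all pairs.** If the Wasserstein contraction bound holds
along every edge of the Hasse diagram, then it holds for all pairs of states. -/
theorem wass_bound_of_hasse_bound {X : Type*} [Fintype X] [PartialOrder X]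
    (hconn : Connects X) (f : X → ℝ) (hf : StrictMono f) (P : Matrix X X ℝ)
    (hstoch : IsStochastic P) (v : ℝ) (hv : 0 ≤ v)
    (hedge : ∀ x y : X, HasseAdj x y →
      wass (pathMetric f) (P x) (P y) ≤ v * pathMetric f x y) :
    ∀ x y : X, wass (pathMetric f) (P x) (P y) ≤ v * pathMetric f x y := by
  intro x y
  have hrow : ∀ x, IsProbVec (P x) := fun x => ⟨hstoch.1 x, hstoch.2 x⟩
  have hpath : ∀ c, HassePath f x y c → wass (pathMetric f) (P x) (P y) ≤ v * c := by
    intro c h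
    induction h with
    | refl x =>
      rw [mul_zero]
      exact wass_self_nonpos (pathMetric_nonneg f) (pathMetric_self f) (hrow x).1
    | @head x y z c hadj _ ih =>
      rw [mul_add]
      refine (wass_triangle (pathMetric_nonneg f) (hconn.pathMetric_triangle f)
        (hrow x) (hrow y) (hrow z)).trans (add_le_add ?_ ih)
      exact (hedge x y hadj).trans (mul_le_mul_of_nonneg_left hadj.pathMetric_le hv)
  obtain rfl | hv := hv.eq_or_lt
  · obtain ⟨c, hc⟩ := HassePath.exists_of_reflTransGen (f := f) (hconn.reflTransGen_hasseAdj x y)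
    simpa using hpath c hc
  · rw [← div_le_iff₀' hv]
    exact hconn.le_pathMetric fun c hc => (div_le_iff₀' hv).2 (hpath c hc)
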